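/- arXiv:1907.00669 — 3 statements merged into one kernel-verified Lean document; each statement's English description precedes it below -/
import Mathlib

section
/- (Leading logarithmic term of I'_4 at the figure-eight.) As h → 0⁺ one has (I'_4(h) − 16/3 − 4h) / (h²·ln h) → −3/2. -/
open Real Set Filter intervalIntegral

/-- Right endpoint of the exterior oval: `x_max(h) = √(1 + √(1+4h))`. -/
noncomputable def xmax (h : ℝ) : ℝ := Real.sqrt (1 + Real.sqrt (1 + 4*h))

/-- Complete elliptic integral `I_i(h) = ∫_{-x_max}^{x_max} x^i √(2h + x² - x⁴/2) dx`. -/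
noncomputable def ellI (i : ℕ) (h : ℝ) : ℝ :=
  ∫ x in (-xmax h)..(xmax h), x^i * Real.sqrt (2*h + x^2 - x^4/2)

/-- Complete elliptic integral `I'_i(h) = ∫_{-x_max}^{x_max} x^i (2h + x² - x⁴/2)^{-1/2} dx`. -/
noncomputable def ellI' (i : ℕ) (h : ℝ) : ℝ :=
  ∫ x in (-xmax h)..(xmax h), x^i / Real.sqrt (2*h + x^2 - x^4/2)

noncomputable def RR (k s : ℝ) : ℝ := s^4 / √(s^2+k) - s^3 + k*s/2

lemma RR_nonneg {k s : ℝ} (hk : 0 < k) (hs : 0 ≤ s) : 0 ≤ RR k s := by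
  unfold RR
  have hq : 0 < √(s^2+k) := Real.sqrt_pos.mpr (by positivity)
  have hq2 : √(s^2+k)^2 = s^2+k := Real.sq_sqrt (by positivity)
  set q := √(s^2+k)
  have hk' : k = q^2 - s^2 := by linarith
  have : s^4/q - s^3 + k*s/2 = s*(q-s)^2*(q+2*s)/(2*q) := by
    rw [hk']; field_simp; ring
  rw [this]; positivity

lemma RR_le {k s : ℝ} (hk : 0 < k) (hs : 0 ≤ s) : s * RR k s ≤ 3*k^2/8 := by
  unfold RR
  have hq : 0 < √(s^2+k) := Real.sqrt_pos.mpr (by positivity)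
  have hq2 : √(s^2+k)^2 = s^2+k := Real.sq_sqrt (by positivity)
  have hqs : s ≤ √(s^2+k) := Real.le_sqrt_of_sq_le (by linarith)
  set q := √(s^2+k)
  have hk' : k = q^2 - s^2 := by linarith
  have : 3*k^2/8 - s*(s^4/q - s^3 + k*s/2) = (q-s)^3*(3*q^2+9*q*s+8*s^2)/(8*q) := by
    rw [hk']; field_simp; ring
  have h2 : 0 ≤ (q-s)^3*(3*q^2+9*q*s+8*s^2)/(8*q) := by
    have : 0 ≤ q - s := by linarith
    positivity
  linarith

lemma RR_cont {k : ℝ} (hk : 0 < k) : Continuous (RR k) := by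
  unfold RR
  have : ∀ s : ℝ, √(s^2+k) ≠ 0 := fun s => (Real.sqrt_pos.mpr (by positivity)).ne'
  fun_prop (disch := assumption)

noncomputable def Phi (k s : ℝ) : ℝ := s^3*√(s^2+k)/4 - 3*k*s*√(s^2+k)/8
  + 3*k^2/8 * Real.log (s+√(s^2+k)) - s^4/4 + k*s^2/4

lemma Phi_deriv {k s : ℝ} (hk : 0 < k) (hs : 0 ≤ s) : HasDerivAt (Phi k) (RR k s) s := by
  have hp : 0 < s^2+k := by positivity
  have hq : 0 < √(s^2+k) := Real.sqrt_pos.mpr hp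
  have hq2 : √(s^2+k)^2 = s^2+k := Real.sq_sqrt hp.le
  have h1 : HasDerivAt (fun s : ℝ => √(s^2+k)) (s/√(s^2+k)) s := by
    have := ((hasDerivAt_pow 2 s).add_const k).sqrt hp.ne'
    refine this.congr_deriv ?_
    push_cast; field_simp
  have hl : HasDerivAt (fun s : ℝ => Real.log (s + √(s^2+k)))
      ((1 + s/√(s^2+k))/(s + √(s^2+k))) s :=
    HasDerivAt.log (f := fun s : ℝ => s + √(s^2+k)) ((hasDerivAt_id' s).add h1) (by positivity)
  have h := (((((hasDerivAt_pow 3 s).mul h1).div_const 4).sub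
    ((((hasDerivAt_id' s).const_mul (3*k)).mul h1).div_const 8)).add (hl.const_mul (3*k^2/8))).sub
      ((hasDerivAt_pow 4 s).div_const 4) |>.add (((hasDerivAt_pow 2 s).const_mul k).div_const 4)
  have h' : HasDerivAt (Phi k) _ s := h
  refine h'.congr_deriv ?_
  unfold RR
  push_cast
  set q := √(s^2+k)
  have hk' : k = q^2 - s^2 := by linarith
  have : s + q ≠ 0 := by positivity
  rw [hk']; field_simp; ring

lemma int_RR_cos {k : ℝ} (hk : 0 < k) :
    ∫ t in (0:ℝ)..(π/2), RR k (sin t) * cos t = Phi k 1 - Phi k 0 := by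
  have h := integral_eq_sub_of_hasDerivAt (a := 0) (b := π/2) (f := fun t => Phi k (sin t))
    (f' := fun t => RR k (sin t) * cos t) ?_ ?_
  · simpa using h
  · intro t ht
    rw [uIcc_of_le (by positivity)] at ht
    have : 0 ≤ sin t := sin_nonneg_of_nonneg_of_le_pi ht.1 (by linarith [ht.2, pi_pos])
    exact (Phi_deriv hk this).comp t (hasDerivAt_sin t)
  · apply Continuous.intervalIntegrable
    have := RR_cont hk
    fun_prop

lemma int_rest {k : ℝ} (hk : 0 < k) :
    0 ≤ (∫ t in (0:ℝ)..(π/2), RR k (sin t) * (1 - cos t)) ∧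
    (∫ t in (0:ℝ)..(π/2), RR k (sin t) * (1 - cos t)) ≤ k^2 := by
  have hc := RR_cont hk
  have hp := pi_pos
  have key : ∀ t ∈ Icc (0:ℝ) (π/2), 0 ≤ RR k (sin t) * (1 - cos t) ∧
      RR k (sin t) * (1 - cos t) ≤ 3*k^2/8 := by
    intro t ht
    have hs : 0 ≤ sin t := sin_nonneg_of_nonneg_of_le_pi ht.1 (by linarith [ht.2])
    have hcc : 0 ≤ cos t := cos_nonneg_of_neg_pi_div_two_le_of_le (by linarith [ht.1]) ht.2
    have hR := RR_nonneg hk hs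
    have h1 := cos_le_one t
    refine ⟨mul_nonneg hR (by linarith), le_trans ?_ (RR_le hk hs)⟩
    rw [mul_comm]
    apply mul_le_mul_of_nonneg_right _ hR
    nlinarith [sin_sq_add_cos_sq t, mul_nonneg hs hcc]
  constructor
  · exact integral_nonneg (by positivity) fun t ht => (key t ht).1
  · have := integral_mono_on (a := 0) (b := π/2) (f := fun t => RR k (sin t) * (1 - cos t))
      (g := fun _ => 3*k^2/8) (μ := MeasureTheory.volume) (by positivity)
      (by apply Continuous.intervalIntegrable; fun_prop)
      (by apply Continuous.intervalIntegrable; fun_prop) (fun t ht => (key t ht).2)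
    refine this.trans ?_
    simp
    nlinarith [sq_nonneg k, pi_lt_four]

noncomputable def JJ (k : ℝ) : ℝ := ∫ t in (0:ℝ)..(π/2), sin t^4/√(sin t^2+k)

lemma JJ_bound {k : ℝ} (hk : 0 < k) (hk1 : k < 1) :
    ∃ B, |B| ≤ 10 ∧ 2 * JJ k = 4/3 - k + k^2 * (-(3/8) * Real.log k + B) := by
  have hc := RR_cont hk
  have e : JJ k = (∫ t in (0:ℝ)..(π/2), sin t^3) - k/2 * (∫ t in (0:ℝ)..(π/2), sin t)
      + (∫ t in (0:ℝ)..(π/2), RR k (sin t) * cos t)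
      + (∫ t in (0:ℝ)..(π/2), RR k (sin t) * (1 - cos t)) := by
    unfold JJ
    rw [← integral_const_mul, ← integral_sub, ← integral_add, ← integral_add]
    · congr 1; ext t; unfold RR; ring
    all_goals apply Continuous.intervalIntegrable; fun_prop
  have e3 : (∫ t in (0:ℝ)..(π/2), sin t^3) = 2/3 := by
    rw [integral_sin_pow]; simp; norm_num
  have e1 : (∫ t in (0:ℝ)..(π/2), sin t) = 1 := by simp
  rw [e3, e1, int_RR_cos hk] at e
  obtain ⟨d0, d1⟩ := int_rest hk
  set D := ∫ t in (0:ℝ)..(π/2), RR k (sin t) * (1 - cos t)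
  have hq2 : √(1+k)^2 = 1+k := Real.sq_sqrt (by positivity)
  have hq1 : 1 ≤ √(1+k) := Real.one_le_sqrt.mpr (by linarith)
  have hP : Phi k 1 - Phi k 0 = k^2 * (-(3*√(1+k)+4)/(8*(√(1+k)+1)^2)
      + 3/8*Real.log (1+√(1+k)) - 3/16*Real.log k) := by
    unfold Phi
    simp only [one_pow]
    rw [show (0:ℝ)+√(0^2+k) = √k by simp, Real.log_sqrt hk.le]
    set q := √(1+k)
    have hk' : k = q^2 - 1 := by linarith
    generalize Real.log k = L
    rw [hk']
    have : q + 1 ≠ 0 := by positivity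
    field_simp; ring
  have hq3 : √(1+k) ≤ 2 := by nlinarith
  set q := √(1+k)
  refine ⟨2*(-(3*q+4)/(8*(q+1)^2)) + 3/4*Real.log (1+q) + 2*D/k^2, ?_, ?_⟩
  · have a1 : 0 ≤ Real.log (1+q) := Real.log_nonneg (by linarith)
    have a2 : Real.log (1+q) ≤ q := by
      have := Real.log_le_sub_one_of_pos (show 0 < 1+q by linarith); linarith
    have a3 : 0 ≤ D/k^2 := by positivity
    have a4 : D/k^2 ≤ 1 := by rw [div_le_one (by positivity)]; exact d1
    have a5 : 0 ≤ (3*q+4)/(8*(q+1)^2) := by positivity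
    have a6 : (3*q+4)/(8*(q+1)^2) ≤ 1 := by rw [div_le_one (by positivity)]; nlinarith
    rw [neg_div, mul_div_assoc, abs_le]
    constructor <;> linarith
  · rw [e, hP]; field_simp; ring

lemma ell_eq {k : ℝ} (hk : 0 < k) (hk1 : k < 1) :
    ellI' 4 (k/(1-k)^2) = 4/√(1-k)^3 * (2 * JJ k) := by
  have hw : 0 < √(1-k) := Real.sqrt_pos.mpr (by linarith)
  have hw2 : √(1-k)^2 = 1-k := Real.sq_sqrt (by linarith)
  have h2 : (√2)^2 = (2:ℝ) := Real.sq_sqrt (by norm_num)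
  have hp := pi_pos
  have hX : xmax (k/(1-k)^2) = √2/√(1-k) := by
    unfold xmax
    have h1k : (0:ℝ) < 1 - k := by linarith
    rw [show 1 + 4*(k/(1-k)^2) = ((1+k)/(1-k))^2 by field_simp; ring,
      Real.sqrt_sq (by positivity), ← Real.sqrt_div (by norm_num)]
    congr 1; field_simp; ring
  have hXp : 0 < √2/√(1-k) := by positivity
  unfold ellI'
  rw [hX]
  set w := √(1-k) with hwdef
  set X := √2/w with hXdef
  have himg : (fun t => X * sin t) '' Ioo (-(π/2)) (π/2) = Ioo (-X) X := by
    ext x; constructor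
    · rintro ⟨t, ht, rfl⟩
      have a1 : sin t < 1 := by
        rw [← sin_pi_div_two]; exact strictMonoOn_sin ⟨ht.1.le, ht.2.le⟩ ⟨by linarith, le_rfl⟩ ht.2
      have a2 : -1 < sin t := by
        rw [← sin_pi_div_two, ← sin_neg]
        exact strictMonoOn_sin ⟨le_rfl, by linarith⟩ ⟨ht.1.le, ht.2.le⟩ ht.1
      constructor <;> simp only <;> nlinarith
    · rintro ⟨h1, h2⟩
      have b1 : x/X < 1 := by rw [div_lt_one hXp]; exact h2
      have b2 : -1 < x/X := by rw [lt_div_iff₀ hXp]; linarith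
      refine ⟨arcsin (x/X), ⟨neg_pi_div_two_lt_arcsin.mpr b2, arcsin_lt_pi_div_two.mpr b1⟩, ?_⟩
      simp only
      rw [sin_arcsin b2.le b1.le]; field_simp
  have hinj : InjOn (fun t => X * sin t) (Ioo (-(π/2)) (π/2)) := by
    intro a ha b hb hab
    have := mul_left_cancel₀ hXp.ne' hab
    exact injOn_sin ⟨ha.1.le, ha.2.le⟩ ⟨hb.1.le, hb.2.le⟩ this
  rw [integral_of_le (by linarith), MeasureTheory.integral_Ioc_eq_integral_Ioo, ← himg,
    MeasureTheory.integral_image_eq_integral_abs_deriv_smul measurableSet_Ioo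
      (f' := fun t => X * cos t)
      (fun t _ => ((hasDerivAt_sin t).const_mul X).hasDerivWithinAt) hinj]
  have hpt : ∀ t ∈ Ioo (-(π/2)) (π/2), |X * cos t| • ((X * sin t)^4 /
      √(2*(k/(1-k)^2) + (X*sin t)^2 - (X*sin t)^4/2))
      = 4/w^3 * (sin t^4/√(sin t^2+k)) := by
    intro t ht
    have hc : 0 < cos t := cos_pos_of_mem_Ioo ht
    have hq : 0 < √(sin t^2+k) := Real.sqrt_pos.mpr (by positivity)
    have hq2 : √(sin t^2+k)^2 = sin t^2+k := Real.sq_sqrt (by positivity)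
    have : 2*(k/(1-k)^2) + (X*sin t)^2 - (X*sin t)^4/2
        = (X/w * cos t * √(sin t^2+k))^2 := by
      rw [mul_pow (X/w * cos t), mul_pow (X/w), hq2, cos_sq', hXdef, show (√2/w*sin t)^4 = (√2^2)^2/w^4*sin t^4 by
        field_simp, mul_pow, div_pow, div_pow, div_pow, h2, ← hw2]
      have hk' : k = 1 - w^2 := by linarith
      clear_value w
      subst hk'
      field_simp; ring
    rw [this, Real.sqrt_sq (by positivity), abs_of_pos (by positivity), smul_eq_mul]
    have : X^4 = 4/w^4 := by
      rw [hXdef, div_pow, show √2^4 = (√2^2)^2 by ring, h2]; norm_num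
    rw [mul_pow, this]
    field_simp
  rw [MeasureTheory.setIntegral_congr_fun measurableSet_Ioo hpt,
    ← MeasureTheory.integral_Ioc_eq_integral_Ioo, ← integral_of_le (by linarith),
    integral_const_mul]
  congr 1
  have hcont : Continuous (fun t => sin t^4/√(sin t^2+k)) := by
    have : ∀ t : ℝ, √(sin t^2+k) ≠ 0 := fun s => (Real.sqrt_pos.mpr (by positivity)).ne'
    fun_prop (disch := assumption)
  rw [← integral_add_adjacent_intervals (b := 0) (hcont.intervalIntegrable _ _)
    (hcont.intervalIntegrable _ _)]
  have := integral_comp_neg (a := 0) (b := π/2) (fun t => sin t^4/√(sin t^2+k))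
  simp only [sin_neg, neg_zero] at this
  rw [← this]
  unfold JJ
  rw [two_mul]
  congr 2; ext t
  rw [neg_sq, show (-sin t)^4 = sin t^4 by ring]

lemma ell_expand {k : ℝ} (hk : 0 < k) (hk1 : k < 1) :
    ∃ B, |B| ≤ 10 ∧ ellI' 4 (k/(1-k)^2) - 16/3 - 4*(k/(1-k)^2) =
      k^2 * (-(4/3)*(4*√(1-k)^2+5*√(1-k)+3)/(√(1-k)^4*(1+√(1-k))^2)
        + 4/√(1-k)^3 * (-(3/8) * Real.log k + B)) := by
  obtain ⟨B, hB, e⟩ := JJ_bound hk hk1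
  refine ⟨B, hB, ?_⟩
  rw [ell_eq hk hk1, e]
  have hw : 0 < √(1-k) := Real.sqrt_pos.mpr (by linarith)
  have hw2 : √(1-k)^2 = 1-k := Real.sq_sqrt (by linarith)
  rw [← hw2]
  set w := √(1-k)
  generalize Real.log k = L
  have hk' : k = 1 - w^2 := by linarith
  have : 1 + w ≠ 0 := by positivity
  clear_value w
  subst hk'
  rw [Real.sqrt_sq hw.le]
  field_simp
  ring

noncomputable def kk (h : ℝ) : ℝ := (√(1+4*h)-1)/(√(1+4*h)+1)

lemma kk_spec {h : ℝ} (hh : 0 < h) : 0 < kk h ∧ kk h < 1 ∧ h = kk h/(1-kk h)^2 := by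
  unfold kk
  have hs : 1 < √(1+4*h) := by rw [Real.lt_sqrt (by norm_num)]; linarith
  have hs2 : √(1+4*h)^2 = 1+4*h := Real.sq_sqrt (by linarith)
  set s := √(1+4*h)
  have h1 : 0 < s - 1 := by linarith
  refine ⟨by positivity, by rw [div_lt_one (by linarith)]; linarith, ?_⟩
  rw [show 1 - (s-1)/(s+1) = 2/(s+1) by field_simp; ring]
  have : h = (s^2-1)/4 := by linarith
  rw [this]; field_simp; ring

lemma kk_tendsto : Tendsto kk (nhdsWithin 0 (Ioi 0)) (nhds 0) := by
  have : ContinuousAt kk 0 := by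
    unfold kk
    apply ContinuousAt.div (by fun_prop) (by fun_prop)
    positivity
  have h0 : kk 0 = 0 := by simp [kk]
  have h := this.tendsto
  rw [h0] at h
  exact h.mono_left nhdsWithin_le_nhds

/-- Leading logarithmic term of `I₄'` at the figure-eight. -/
theorem ellI4'_log_asymptotics :
    Tendsto (fun h => (ellI' 4 h - 16/3 - 4*h) / (h^2 * Real.log h))
      (nhdsWithin 0 (Ioi 0)) (nhds (-3/2)) := by
  have hex : ∀ h : ℝ, ∃ B, |B| ≤ 10 ∧ (0 < h → ellI' 4 h - 16/3 - 4*h =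
      (kk h)^2 * (-(4/3)*(4*√(1-kk h)^2+5*√(1-kk h)+3)/(√(1-kk h)^4*(1+√(1-kk h))^2)
        + 4/√(1-kk h)^3 * (-(3/8) * Real.log (kk h) + B))) := by
    intro h
    by_cases hh : 0 < h
    · obtain ⟨a, b, c⟩ := kk_spec hh
      obtain ⟨B, hB, e⟩ := ell_expand a b
      rw [← c] at e
      exact ⟨B, hB, fun _ => e⟩
    · exact ⟨0, by norm_num, fun h' => absurd h' hh⟩
  choose B hB hE using hex
  have hL : Tendsto (fun h => (Real.log h)⁻¹) (nhdsWithin 0 (Ioi 0)) (nhds 0) :=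
    tendsto_inv_atBot_zero.comp Real.tendsto_log_nhdsGT_zero
  have hBL : Tendsto (fun h => B h * (Real.log h)⁻¹) (nhdsWithin 0 (Ioi 0)) (nhds 0) := by
    have := hL.abs.const_mul 10
    rw [abs_zero, mul_zero] at this
    refine squeeze_zero_norm (fun h => ?_) this
    rw [Real.norm_eq_abs, abs_mul]
    exact mul_le_mul_of_nonneg_right (hB h) (abs_nonneg _)
  have hk := kk_tendsto
  have hcont : ∀ f : ℝ → ℝ, ContinuousAt f 0 →
      Tendsto (fun h => f (kk h)) (nhdsWithin 0 (Ioi 0)) (nhds (f 0)) :=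
    fun f hf => hf.tendsto.comp hk
  have t1 := hcont (fun k => (1-k)^4) (by fun_prop)
  have t2 := hcont (fun k => -(4/3)*(4*√(1-k)^2+5*√(1-k)+3)/(√(1-k)^4*(1+√(1-k))^2))
    (by apply ContinuousAt.div (by fun_prop) (by fun_prop); simp)
  have t3 := hcont (fun k => 4/√(1-k)^3)
    (by apply ContinuousAt.div (by fun_prop) (by fun_prop); simp)
  have t4 := hcont (fun k => Real.log (1-k))
    (by apply ContinuousAt.log (by fun_prop); simp)
  have T := t1.mul ((t2.mul hL).add (t3.mul
    (((((t4.const_mul 2).mul hL).const_add 1).const_mul (-(3/8))).add hBL)))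
  have hval : (-3/2 : ℝ) = (1-0)^4 * (-(4/3)*(4*√(1-0)^2+5*√(1-0)+3)/(√(1-0)^4*(1+√(1-0))^2) * 0
      + 4/√(1-0)^3 * (-(3/8) * (1 + 2 * Real.log (1-0) * 0) + 0)) := by
    simp; norm_num
  rw [hval]
  refine T.congr' ?_
  have hlt : ∀ᶠ h : ℝ in nhdsWithin 0 (Ioi 0), h < 1 :=
    nhdsWithin_le_nhds (Iio_mem_nhds one_pos)
  filter_upwards [self_mem_nhdsWithin, hlt] with h hh h1
  have hh : 0 < h := hh
  obtain ⟨a, b, c⟩ := kk_spec hh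
  have hl : Real.log h ≠ 0 := (Real.log_neg hh h1).ne
  have h1k : 0 < 1 - kk h := by linarith
  have hlog : Real.log (kk h) = Real.log h + 2 * Real.log (1 - kk h) := by
    have := congrArg Real.log c
    rw [Real.log_div a.ne' (by positivity), Real.log_pow] at this
    push_cast at this; linarith
  rw [hE h hh, hlog]
  generalize Real.log (1 - kk h) = M
  generalize -(4/3)*(4*√(1-kk h)^2+5*√(1-kk h)+3)/(√(1-kk h)^4*(1+√(1-kk h))^2) = P
  generalize 4/√(1-kk h)^3 = Q
  generalize Real.log h = L at *
  generalize B h = b at *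
  generalize kk h = k at *
  have := a.ne'
  have := h1k.ne'
  rw [c]
  field_simp
end

section
/- (Asymptotics of the Melnikov combination 5I_2 − I'_4.) As h → 0⁺ one has (5·I_2(h) − I'_4(h)) / h → 16, and moreover (5·I_2(h) − I'_4(h) − 16h) / (h²·ln h) → 4. -/
open Real Set Filter intervalIntegral

lemma aux_arcsin_int (m : ℝ) (hm : 0 < m) :
    IntervalIntegrable (fun x => 1 / √(m^2 - x^2)) MeasureTheory.volume (-m) m := by
  refine intervalIntegrable_deriv_of_nonneg (g := fun x => arcsin (x / m)) ?_ ?_ ?_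
  · exact (Real.continuous_arcsin.comp (continuous_id.div_const m)).continuousOn
  · intro x hx
    rw [min_eq_left (by linarith), max_eq_right (by linarith)] at hx
    obtain ⟨h1, h2⟩ := hx
    have h3 : x / m ≠ -1 := by
      intro h; rw [div_eq_iff hm.ne'] at h; linarith
    have h4 : x / m ≠ 1 := by
      intro h; rw [div_eq_iff hm.ne'] at h; linarith
    have := (Real.hasDerivAt_arcsin h3 h4).comp x ((hasDerivAt_id x).div_const m)
    refine HasDerivAt.congr_deriv this ?_
    have e : m^2 - x^2 = m^2 * (1 - (x/m)^2) := by field_simp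
    rw [e, Real.sqrt_mul (by positivity), Real.sqrt_sq hm.le]
    simp only [one_div, mul_inv, id]
    ring
  · intro x _
    positivity

lemma aux_int_n (m b : ℝ) (hm : 0 < m) (hb : 0 < b) (n : ℕ) :
    IntervalIntegrable (fun x => x^n / √((m^2 - x^2) * (x^2 + b) / 2))
      MeasureTheory.volume (-m) m := by
  have := (aux_arcsin_int m hm).mul_continuousOn (g := fun x => x^n / √((x^2+b)/2)) (by
    apply Continuous.continuousOn
    refine Continuous.div (by fun_prop) (by fun_prop) ?_
    intro x; positivity)
  refine this.congr ?_
  intro x hx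
  rw [uIoc_of_le (by linarith)] at hx
  have h0 : 0 ≤ m^2 - x^2 := by nlinarith [hx.1, hx.2]
  simp only
  rw [mul_div_assoc, Real.sqrt_mul h0]
  simp only [div_eq_mul_inv, mul_inv]
  ring

lemma aux_key (m b : ℝ) (hm : 0 < m) (hb : 0 < b) (hmb : m^2 - b = 2) :
    5 * (∫ x in (-m)..m, x^2 * √((m^2 - x^2) * (x^2 + b) / 2))
      - (∫ x in (-m)..m, x^4 / √((m^2 - x^2) * (x^2 + b) / 2))
    = m^2 * b * ∫ x in (-m)..m, x^2 / √((m^2 - x^2) * (x^2 + b) / 2) := by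
  have i4 := aux_int_n m b hm hb 4
  have i2 := aux_int_n m b hm hb 2
  have ic : IntervalIntegrable (fun x => x^2 * √((m^2 - x^2) * (x^2 + b) / 2))
      MeasureTheory.volume (-m) m := by
    apply Continuous.intervalIntegrable; fun_prop
  have it := ((ic.const_mul 5).sub i4).sub (i2.const_mul (m^2*b))
  have := integral_eq_sub_of_hasDerivAt_of_le (a := -m) (b := m)
    (f := fun x => x^3 * √((m^2 - x^2) * (x^2 + b) / 2)) (by linarith)
    (by apply Continuous.continuousOn; fun_prop) (fun x hx => ?_) it
  · rw [integral_sub ((ic.const_mul 5).sub i4) (i2.const_mul (m^2*b)),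
      integral_sub (ic.const_mul 5) i4, integral_const_mul, integral_const_mul] at this
    simp only [sub_self, neg_sq, zero_mul, zero_div, Real.sqrt_zero, mul_zero] at this
    linarith
  · obtain ⟨h1, h2⟩ := hx
    have hP : 0 < (m^2 - x^2) * (x^2 + b) / 2 := by
      have : 0 < m^2 - x^2 := by nlinarith
      positivity
    have hd : HasDerivAt (fun x : ℝ => (m^2 - x^2) * (x^2 + b) / 2)
        ((-(2*x)) * (x^2+b) / 2 + (m^2-x^2) * (2*x) / 2) x := by
      have := ((((hasDerivAt_pow 2 x).const_sub (m^2)).mul ((hasDerivAt_pow 2 x).add_const b)).div_const 2)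
      refine HasDerivAt.congr_deriv this ?_
      simp; ring
    have := (hasDerivAt_pow 3 x).mul (hd.sqrt hP.ne')
    refine HasDerivAt.congr_deriv this ?_
    have hs := Real.sq_sqrt hP.le
    have hs0 := Real.sqrt_pos.2 hP
    set S := √((m^2 - x^2) * (x^2 + b) / 2)
    have hb' : b = m^2 - 2 := by linarith
    subst hb'
    field_simp
    simp
    rw [hs]
    ring

lemma aux_M (m : ℝ) (hm : 0 < m) :
    IntervalIntegrable (fun x => x / √(m^2 - x^2)) MeasureTheory.volume 0 m ∧
    ∫ x in (0:ℝ)..m, x / √(m^2 - x^2) = m := by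
  have hc : ContinuousOn (fun x => - √(m^2 - x^2)) (Icc 0 m) := by
    apply Continuous.continuousOn; fun_prop
  have hd : ∀ x ∈ Ioo 0 m, HasDerivAt (fun x => - √(m^2 - x^2)) (x / √(m^2 - x^2)) x := by
    intro x hx
    have h0 : 0 < m^2 - x^2 := by nlinarith [hx.1, hx.2]
    have := (((hasDerivAt_pow 2 x).const_sub (m^2)).sqrt h0.ne').neg
    refine HasDerivAt.congr_deriv this ?_
    simp; field_simp
  have hi : IntervalIntegrable (fun x => x / √(m^2 - x^2)) MeasureTheory.volume 0 m := by
    refine intervalIntegrable_deriv_of_nonneg (g := fun x => - √(m^2 - x^2)) ?_ ?_ ?_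
    · rwa [uIcc_of_le hm.le]
    · rwa [min_eq_left hm.le, max_eq_right hm.le]
    · rw [min_eq_left hm.le, max_eq_right hm.le]
      intro x hx
      have := hx.1
      positivity
  refine ⟨hi, ?_⟩
  rw [integral_eq_sub_of_hasDerivAt_of_le hm.le hc hd hi]
  simp [Real.sqrt_sq hm.le]

lemma aux_L (m c : ℝ) (hm : 0 < m) (hc0 : 0 < c) :
    IntervalIntegrable (fun x => x / (√(m^2 - x^2) * (x^2 + c))) MeasureTheory.volume 0 m ∧
    ∫ x in (0:ℝ)..m, x / (√(m^2 - x^2) * (x^2 + c))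
      = (2 * log (√(m^2+c) + m) - log c) / (2 * √(m^2+c)) := by
  have hK2 := Real.sq_sqrt (show 0 ≤ m^2 + c by positivity)
  have hK : m < √(m^2+c) := by
    rw [Real.lt_sqrt hm.le]; linarith
  set K := √(m^2+c)
  have hw : ∀ x : ℝ, √(m^2 - x^2) < K := by
    intro x
    refine lt_of_le_of_lt ?_ hK
    rw [Real.sqrt_le_left hm.le]
    nlinarith [sq_nonneg x]
  have hc : ContinuousOn (fun x => (log (K - √(m^2 - x^2)) - log (K + √(m^2 - x^2))) / (2*K)) (Icc 0 m) := by
    apply Continuous.continuousOn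
    refine Continuous.div_const (Continuous.sub ?_ ?_) _
    · refine Continuous.log (by fun_prop) ?_
      intro x; linarith [hw x]
    · refine Continuous.log (by fun_prop) ?_
      intro x; have := Real.sqrt_nonneg (m^2-x^2); linarith [hw x]
  have hd : ∀ x ∈ Ioo 0 m, HasDerivAt (fun x => (log (K - √(m^2 - x^2)) - log (K + √(m^2 - x^2))) / (2*K))
      (x / (√(m^2 - x^2) * (x^2 + c))) x := by
    intro x hx
    have h0 : 0 < m^2 - x^2 := by nlinarith [hx.1, hx.2]
    have d1 := (((hasDerivAt_pow 2 x).const_sub (m^2)).sqrt h0.ne')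
    have hwx := hw x
    have hs0 := Real.sqrt_pos.2 h0
    have hs := Real.sq_sqrt h0.le
    have d2 := (((d1.const_sub K).log (by linarith)).sub
      ((d1.const_add K).log (by linarith))).div_const (2*K)
    refine HasDerivAt.congr_deriv d2 ?_
    set w := √(m^2 - x^2)
    have e : x^2 + c = (K - w) * (K + w) := by ring_nf; linarith
    have e1 : K - w ≠ 0 := by linarith
    have e2 : K + w ≠ 0 := by linarith
    have e3 : K ≠ 0 := by linarith
    rw [e]
    simp
    field_simp
    ring
  have hi : IntervalIntegrable (fun x => x / (√(m^2 - x^2) * (x^2 + c))) MeasureTheory.volume 0 m := by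
    refine intervalIntegrable_deriv_of_nonneg (g := fun x => (log (K - √(m^2 - x^2)) - log (K + √(m^2 - x^2))) / (2*K)) ?_ ?_ ?_
    · rwa [uIcc_of_le hm.le]
    · rwa [min_eq_left hm.le, max_eq_right hm.le]
    · rw [min_eq_left hm.le, max_eq_right hm.le]
      intro x hx
      have := hx.1
      positivity
  refine ⟨hi, ?_⟩
  rw [integral_eq_sub_of_hasDerivAt_of_le hm.le hc hd hi]
  have : log c = log (K - m) + log (K + m) := by
    rw [← Real.log_mul (by linarith) (by linarith)]
    congr 1
    ring_nf; linarith
  simp [Real.sqrt_sq hm.le]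
  rw [this]; ring

lemma aux_bounds (m b : ℝ) (hm : 0 < m) (hb : 0 < b) :
    √2 * b * ((2 * log (√(m^2+3*b/4) + m) - log (3*b/4)) / (2 * √(m^2+3*b/4)))
      ≤ 2 * √2 * m - (∫ x in (-m)..m, x^2 / √((m^2 - x^2) * (x^2 + b) / 2)) ∧
    2 * √2 * m - (∫ x in (-m)..m, x^2 / √((m^2 - x^2) * (x^2 + b) / 2)) ≤
    √2 * b * ((2 * log (√(m^2+b/2) + m) - log (b/2)) / (2 * √(m^2+b/2))) := by
  have i2 := aux_int_n m b hm hb 2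
  have i20 : IntervalIntegrable (fun x => x^2 / √((m^2 - x^2) * (x^2 + b) / 2))
      MeasureTheory.volume 0 m := i2.mono_set (by
        rw [uIcc_of_le hm.le, uIcc_of_le (by linarith)]
        exact Icc_subset_Icc (by linarith) le_rfl)
  have i21 : IntervalIntegrable (fun x => x^2 / √((m^2 - x^2) * (x^2 + b) / 2))
      MeasureTheory.volume (-m) 0 := i2.mono_set (by
        rw [uIcc_of_le (by linarith), uIcc_of_le (by linarith)]
        exact Icc_subset_Icc le_rfl (by linarith))
  have hsym : (∫ x in (-m)..m, x^2 / √((m^2 - x^2) * (x^2 + b) / 2))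
      = 2 * ∫ x in (0:ℝ)..m, x^2 / √((m^2 - x^2) * (x^2 + b) / 2) := by
    rw [← integral_add_adjacent_intervals i21 i20]
    have := integral_comp_neg (a := 0) (b := m) (fun x => x^2 / √((m^2 - x^2) * (x^2 + b) / 2))
    simp only [neg_zero, neg_sq] at this
    rw [← this]; ring
  obtain ⟨iM, eM⟩ := aux_M m hm
  have hD : 2 * √2 * m - (∫ x in (-m)..m, x^2 / √((m^2 - x^2) * (x^2 + b) / 2))
      = ∫ x in (0:ℝ)..m, (2 * √2 * (x / √(m^2 - x^2)) - 2 * (x^2 / √((m^2 - x^2) * (x^2 + b) / 2))) := by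
    rw [integral_sub (iM.const_mul _) (i20.const_mul _), integral_const_mul, integral_const_mul, eM, hsym]
  have hpt : ∀ x ∈ Ioo 0 m,
      (√2 * b * (x / (√(m^2 - x^2) * (x^2 + 3*b/4))) ≤
        2 * √2 * (x / √(m^2 - x^2)) - 2 * (x^2 / √((m^2 - x^2) * (x^2 + b) / 2))) ∧
      (2 * √2 * (x / √(m^2 - x^2)) - 2 * (x^2 / √((m^2 - x^2) * (x^2 + b) / 2)) ≤
        √2 * b * (x / (√(m^2 - x^2) * (x^2 + b/2)))) := by
    intro x hx
    obtain ⟨hx0, hx1⟩ := hx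
    have h0 : 0 < m^2 - x^2 := by nlinarith
    have hw := Real.sqrt_pos.2 h0
    have hq0 : 0 < x^2 + b := by positivity
    have hq := Real.sqrt_pos.2 hq0
    have hqs := Real.sq_sqrt hq0.le
    have h2s := Real.sq_sqrt (show (0:ℝ) ≤ 2 by norm_num)
    have h2 := Real.sqrt_pos.2 (show (0:ℝ) < 2 by norm_num)
    rw [Real.sqrt_div (by positivity), Real.sqrt_mul h0.le]
    set w := √(m^2 - x^2)
    set q := √(x^2 + b)
    have hbq : b = q^2 - x^2 := by linarith
    have hqx : x < q := by
      by_contra hcon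
      push Not at hcon
      nlinarith
    have e : 2 * √2 * (x / w) - 2 * (x^2 / (w * q / √2)) = (√2 * x / w) * (2 * (q - x) / q) := by
      field_simp
    have f1 : √2 * b * (x / (w * (x^2 + 3*b/4))) = (√2 * x / w) * (b / (x^2 + 3*b/4)) := by
      field_simp
    have f2 : √2 * b * (x / (w * (x^2 + b/2))) = (√2 * x / w) * (b / (x^2 + b/2)) := by
      field_simp
    rw [e, f1, f2]
    constructor
    · refine mul_le_mul_of_nonneg_left ?_ (by positivity)
      rw [div_le_div_iff₀ (by positivity) hq, hbq]
      have : 2 * (q - x) * (x ^ 2 + 3 * (q ^ 2 - x ^ 2) / 4) - (q^2-x^2)*q = (q-x)^3/2 := by ring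
      have : 0 ≤ (q-x)^3/2 := by have : 0 < q - x := by linarith
                                 positivity
      linarith
    · refine mul_le_mul_of_nonneg_left ?_ (by positivity)
      rw [div_le_div_iff₀ hq (by positivity), hbq]
      have : (q^2-x^2)*q - 2 * (q - x) * (x ^ 2 + (q ^ 2 - x ^ 2) / 2) = (q-x)^2*x + 0 := by ring
      have : 0 ≤ (q-x)^2*x := by positivity
      linarith
  obtain ⟨iL1, eL1⟩ := aux_L m (3*b/4) hm (by positivity)
  obtain ⟨iL2, eL2⟩ := aux_L m (b/2) hm (by positivity)
  rw [hD, ← eL1, ← eL2, ← integral_const_mul, ← integral_const_mul]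
  have iD := (iM.const_mul (2*√2)).sub (i20.const_mul 2)
  constructor
  · exact integral_mono_on_of_le_Ioo hm.le (iL1.const_mul _) iD (fun x hx => (hpt x hx).1)
  · exact integral_mono_on_of_le_Ioo hm.le iD (iL2.const_mul _) (fun x hx => (hpt x hx).2)

lemma aux_facts (h : ℝ) (hh : 0 < h) :
    0 < xmax h ∧ 0 < √(1+4*h) - 1 ∧ (xmax h)^2 - (√(1+4*h) - 1) = 2 ∧
      (xmax h)^2 * (√(1+4*h) - 1) = 4*h := by
  have h1 : 0 ≤ 1 + 4*h := by linarith
  have hr := Real.sq_sqrt h1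
  have hr0 := Real.sqrt_nonneg (1+4*h)
  have hm : (xmax h)^2 = 1 + √(1+4*h) := Real.sq_sqrt (by linarith)
  refine ⟨Real.sqrt_pos.2 (by linarith), ?_, ?_, ?_⟩
  · have : 1 < √(1+4*h) := by rw [Real.lt_sqrt (by norm_num)]; linarith
    linarith
  · rw [hm]; ring
  · rw [hm]; linear_combination hr

lemma aux_main_eq (h : ℝ) (hh : 0 < h) :
    5 * ellI 2 h - ellI' 4 h = 4 * h * ellI' 2 h ∧
    ellI' 2 h = ∫ x in (-xmax h)..(xmax h),
      x^2 / √(((xmax h)^2 - x^2) * (x^2 + (√(1+4*h) - 1)) / 2) := by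
  obtain ⟨hm, hb, h1, h2⟩ := aux_facts h hh
  have e : ∀ x : ℝ, 2*h + x^2 - x^4/2
      = ((xmax h)^2 - x^2) * (x^2 + (√(1+4*h) - 1)) / 2 := by
    intro x
    linear_combination (-1/2) * h2 - x^2/2 * h1
  have := aux_key _ _ hm hb h1
  rw [h2] at this
  unfold ellI ellI'
  simp only [e]
  exact ⟨this, trivial⟩

lemma aux_xmax_tendsto : Tendsto xmax (nhdsWithin 0 (Ioi 0)) (nhds (√2)) := by
  have : Continuous xmax := by unfold xmax; fun_prop
  have h := (this.tendsto 0).mono_left (nhdsWithin_le_nhds (s := Ioi 0))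
  have e : xmax 0 = √2 := by unfold xmax; norm_num
  rwa [e] at h

lemma aux_b_tendsto : Tendsto (fun h : ℝ => (√(1+4*h) - 1) / h) (nhdsWithin 0 (Ioi 0)) (nhds 2) := by
  have h := (tendsto_const_nhds (x := (4:ℝ))).div (aux_xmax_tendsto.pow 2) (by positivity)
  have e : (4:ℝ) / √2^2 = 2 := by norm_num
  rw [e] at h
  refine h.congr' ?_
  filter_upwards [self_mem_nhdsWithin] with h hh
  obtain ⟨hm, hb, h1, h2⟩ := aux_facts h hh
  have hh' : 0 < h := hh
  simp only [Pi.div_apply, Pi.pow_apply]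
  rw [div_eq_div_iff (by positivity) (by positivity)]
  linarith

lemma aux_b0_tendsto : Tendsto (fun h : ℝ => √(1+4*h) - 1) (nhdsWithin 0 (Ioi 0)) (nhds 0) := by
  have : Continuous (fun h : ℝ => √(1+4*h) - 1) := by fun_prop
  have h := (this.tendsto 0).mono_left (nhdsWithin_le_nhds (s := Ioi 0))
  simpa using h

lemma aux_invlog : Tendsto (fun h : ℝ => (log h)⁻¹) (nhdsWithin 0 (Ioi 0)) (nhds 0) :=
  tendsto_inv_atBot_zero.comp Real.tendsto_log_nhdsGT_zero

lemma aux_g (κ : ℝ) (hκ : 0 < κ) :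
    Tendsto (fun h => √2 * (√(1+4*h) - 1) *
      ((2 * log (√((xmax h)^2 + κ * (√(1+4*h) - 1)) + xmax h) - log (κ * (√(1+4*h) - 1)))
        / (2 * √((xmax h)^2 + κ * (√(1+4*h) - 1)))) / (h * log h))
      (nhdsWithin 0 (Ioi 0)) (nhds (-1)) := by
  have h2p : 0 < √2 := by positivity
  have hK : Tendsto (fun h => √((xmax h)^2 + κ * (√(1+4*h) - 1))) (nhdsWithin 0 (Ioi 0)) (nhds (√2)) := by
    have := ((aux_xmax_tendsto.pow 2).add (aux_b0_tendsto.const_mul κ)).sqrt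
    simpa using this
  have hlogK := (hK.add aux_xmax_tendsto).log (by positivity)
  have hlogb := (aux_b_tendsto.const_mul κ).log (by positivity)
  have hall := ((aux_b_tendsto.const_mul √2).mul
    ((((hlogK.const_mul 2).sub hlogb).mul aux_invlog).sub_const 1)).div (hK.const_mul 2) (by positivity)
  have e : √2 * 2 * ((2 * log (√2 + √2) - log (κ * 2)) * 0 - 1) / (2 * √2) = -1 := by
    field_simp; ring
  rw [e] at hall
  refine hall.congr' ?_
  have hlt : ∀ᶠ h : ℝ in nhdsWithin 0 (Ioi 0), h < 1 :=
    nhdsWithin_le_nhds (eventually_lt_nhds one_pos)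
  filter_upwards [self_mem_nhdsWithin, hlt] with h hh h1
  have hh' : 0 < h := hh
  obtain ⟨hm, hb, _, _⟩ := aux_facts h hh
  have hl : log h ≠ 0 := (Real.log_neg hh' h1).ne
  have hlb : log (κ * (√(1+4*h) - 1)) = log (κ * ((√(1+4*h) - 1)/h)) + log h := by
    rw [← Real.log_mul (by positivity) (by positivity)]
    congr 1; field_simp
  have hKp : 0 < √((xmax h)^2 + κ * (√(1+4*h) - 1)) := by positivity
  rw [hlb]
  simp only [Pi.div_apply]
  generalize √((xmax h)^2 + κ * (√(1+4*h) - 1)) = K at *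
  generalize log (κ * ((√(1+4*h) - 1)/h)) = A
  generalize √(1+4*h) - 1 = b at *
  field_simp
  ring

lemma aux_J : Tendsto (fun h => (ellI' 2 h - 4) / (h * log h)) (nhdsWithin 0 (Ioi 0)) (nhds 1) := by
  have hlt : ∀ᶠ h : ℝ in nhdsWithin 0 (Ioi 0), h < 1 :=
    nhdsWithin_le_nhds (eventually_lt_nhds one_pos)
  have hD : Tendsto (fun h => (2 * √2 * xmax h - ellI' 2 h) / (h * log h))
      (nhdsWithin 0 (Ioi 0)) (nhds (-1)) := by
    refine tendsto_of_tendsto_of_tendsto_of_le_of_le' (aux_g (1/2) (by norm_num))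
      (aux_g (3/4) (by norm_num)) ?_ ?_
    · filter_upwards [self_mem_nhdsWithin, hlt] with h hh h1
      have hh' : 0 < h := hh
      obtain ⟨hm, hb, _, _⟩ := aux_facts h hh
      have hneg : h * log h ≤ 0 := by nlinarith [Real.log_neg hh' h1]
      refine div_le_div_of_nonpos_of_le hneg ?_
      rw [(aux_main_eq h hh).2]
      have hbd := (aux_bounds _ _ hm hb).2
      rw [show (√(1+4*h) - 1)/2 = 1/2 * (√(1+4*h) - 1) by ring] at hbd
      exact hbd
    · filter_upwards [self_mem_nhdsWithin, hlt] with h hh h1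
      have hh' : 0 < h := hh
      obtain ⟨hm, hb, _, _⟩ := aux_facts h hh
      have hneg : h * log h ≤ 0 := by nlinarith [Real.log_neg hh' h1]
      refine div_le_div_of_nonpos_of_le hneg ?_
      rw [(aux_main_eq h hh).2]
      have hbd := (aux_bounds _ _ hm hb).1
      rw [show 3*(√(1+4*h) - 1)/4 = 3/4 * (√(1+4*h) - 1) by ring] at hbd
      exact hbd
  have hE : Tendsto (fun h => (2 * √2 * ((√(1+4*h) - 1)/h) / (xmax h + √2)) * (log h)⁻¹)
      (nhdsWithin 0 (Ioi 0)) (nhds 0) := by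
    have := ((aux_b_tendsto.const_mul (2*√2)).div (aux_xmax_tendsto.add_const √2)
      (by positivity)).mul aux_invlog
    simpa using this
  have := hE.sub hD
  rw [show (0:ℝ) - -1 = 1 by norm_num] at this
  refine this.congr' ?_
  filter_upwards [self_mem_nhdsWithin, hlt] with h hh h1
  have hh' : 0 < h := hh
  obtain ⟨hm, hb, hmb, _⟩ := aux_facts h hh
  have hl : log h ≠ 0 := (Real.log_neg hh' h1).ne
  have h2p : 0 < √2 := by positivity
  have h2 : √2^2 = 2 := Real.sq_sqrt (by norm_num)
  have hb' : √(1+4*h) - 1 = (xmax h - √2) * (xmax h + √2) := by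
    ring_nf; ring_nf at hmb; linarith
  rw [hb']
  have hne : xmax h + √2 ≠ 0 := by positivity
  field_simp
  linear_combination (-2) * h2

/-- Asymptotics of the Melnikov combination `5 I₂ - I₄'` at the figure-eight. -/
theorem melnikov_combination_asymptotics :
    Tendsto (fun h => (5 * ellI 2 h - ellI' 4 h) / h)
      (nhdsWithin 0 (Ioi 0)) (nhds 16) ∧
    Tendsto (fun h => (5 * ellI 2 h - ellI' 4 h - 16*h) / (h^2 * Real.log h))
      (nhdsWithin 0 (Ioi 0)) (nhds 4) := by
  have hlt : ∀ᶠ h : ℝ in nhdsWithin 0 (Ioi 0), h < 1 :=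
    nhdsWithin_le_nhds (eventually_lt_nhds one_pos)
  constructor
  · have hz : Tendsto (fun h : ℝ => h * log h) (nhdsWithin 0 (Ioi 0)) (nhds 0) := by
      have := (Real.continuous_mul_log.tendsto 0).mono_left (nhdsWithin_le_nhds (s := Ioi 0))
      simpa using this
    have := ((aux_J.mul hz).const_mul 4).add_const 16
    simp only [mul_zero, zero_add] at this
    refine this.congr' ?_
    filter_upwards [self_mem_nhdsWithin, hlt] with h hh h1
    have hh' : 0 < h := hh
    have hl : log h ≠ 0 := (Real.log_neg hh' h1).ne
    rw [(aux_main_eq h hh).1]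
    field_simp
    ring
  · have := aux_J.const_mul 4
    rw [mul_one] at this
    refine this.congr' ?_
    filter_upwards [self_mem_nhdsWithin, hlt] with h hh h1
    have hh' : 0 < h := hh
    have hl : log h ≠ 0 := (Real.log_neg hh' h1).ne
    rw [(aux_main_eq h hh).1]
    field_simp
    ring
end

section
/- (At most two zeros of the Melnikov functions bifurcate from the figure-eight.) There exists δ > 0 such that for all real numbers a, b, c with (a, b, c) ≠ (0, 0, 0), the function h ↦ a·I_0(h) + b·I_2(h) + c·I'_4(h) has at most two zeros in the interval (0, δ); that is, the set {h ∈ (0, δ) : a·I_0(h) + b·I_2(h) + c·I'_4(h) = 0} contains at most two points. -/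
open Real Set Filter intervalIntegral

open Topology

/-- The smooth square root factor after the substitution `x = √m sin θ`. -/
noncomputable def Rf (m t : ℝ) : ℝ := Real.sqrt ((m * sin t ^ 2 + m - 2) / 2)

noncomputable def Mf (k : ℕ) (m : ℝ) : ℝ := ∫ t in (-(π/2))..(π/2), sin t ^ (2*k) / Rf m t

noncomputable def Wf (k : ℕ) (m : ℝ) : ℝ := ∫ t in (-(π/2))..(π/2), sin t ^ (2*k) * Rf m t

lemma Sf_pos {m : ℝ} (hm : 2 < m) (t : ℝ) : 0 < (m * sin t ^ 2 + m - 2) / 2 := by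
  have : 0 ≤ m * sin t ^ 2 := by positivity
  linarith

lemma Rf_pos {m : ℝ} (hm : 2 < m) (t : ℝ) : 0 < Rf m t := Real.sqrt_pos.2 (Sf_pos hm t)

lemma Rf_sq {m : ℝ} (hm : 2 < m) (t : ℝ) : Rf m t ^ 2 = (m * sin t ^ 2 + m - 2) / 2 :=
  Real.sq_sqrt (Sf_pos hm t).le

lemma Rf_cont (m : ℝ) : Continuous (Rf m) := by unfold Rf; fun_prop

lemma M_cont (k : ℕ) {m : ℝ} (hm : 2 < m) : Continuous (fun t => sin t ^ (2*k) / Rf m t) :=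
  (by fun_prop : Continuous fun t : ℝ => sin t ^ (2*k)).div (Rf_cont m) fun t => (Rf_pos hm t).ne'

lemma Wf_eq (k : ℕ) {m : ℝ} (hm : 2 < m) : Wf k m = (m * Mf (k+1) m + (m-2) * Mf k m) / 2 := by
  unfold Wf Mf
  have h1 := (M_cont k hm).intervalIntegrable (μ := MeasureTheory.volume) (-(π/2)) (π/2)
  have h2 := (M_cont (k+1) hm).intervalIntegrable (μ := MeasureTheory.volume) (-(π/2)) (π/2)
  rw [← intervalIntegral.integral_const_mul, ← intervalIntegral.integral_const_mul,
    ← intervalIntegral.integral_add (h2.const_mul _) (h1.const_mul _),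
    ← intervalIntegral.integral_div]
  refine intervalIntegral.integral_congr fun t _ => ?_
  have h := Rf_pos hm t
  have h' := Rf_sq hm t
  field_simp
  rw [h']
  ring

lemma Rf_deriv {m : ℝ} (hm : 2 < m) (t : ℝ) :
    HasDerivAt (Rf m) (m * sin t * cos t / (2 * Rf m t)) t := by
  have h1 : HasDerivAt (fun t => (m * sin t ^ 2 + m - 2) / 2) (m * sin t * cos t) t := by
    refine ((((((hasDerivAt_sin t).pow 2).const_mul m).add_const m).sub_const 2).div_const
      2).congr_deriv ?_
    push_cast
    ring
  exact h1.sqrt (Sf_pos hm t).ne'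

lemma E1 {m : ℝ} (hm : 2 < m) : (m-2) * Mf 0 m + 4 * Mf 1 m - 3 * m * Mf 2 m = 0 := by
  have key : ∫ t in (-(π/2))..(π/2), ((m-2) * (sin t ^ (2*0) / Rf m t) + 4 * (sin t ^ (2*1) / Rf m t)
      - 3 * m * (sin t ^ (2*2) / Rf m t)) =
      2 * sin (π/2) * cos (π/2) * Rf m (π/2) - 2 * sin (-(π/2)) * cos (-(π/2)) * Rf m (-(π/2)) := by
    refine intervalIntegral.integral_eq_sub_of_hasDerivAt
      (f := fun t => 2 * sin t * cos t * Rf m t) (fun t _ => ?_) ?_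
    · have h := Rf_pos hm t
      have h' := Rf_sq hm t
      refine ((((hasDerivAt_sin t).const_mul 2).mul (hasDerivAt_cos t)).mul
        (Rf_deriv hm t)).congr_deriv ?_
      simp only [Pi.mul_apply]
      field_simp
      have hc : cos t ^ 2 = 1 - sin t ^ 2 := by rw [cos_sq']
      ring_nf
      rw [h', hc]
      ring
    · apply Continuous.intervalIntegrable
      have h0 := M_cont 0 hm
      have h1 := M_cont 1 hm
      have h2 := M_cont 2 hm
      fun_prop
  have h0 := (M_cont 0 hm).intervalIntegrable (μ := MeasureTheory.volume) (-(π/2)) (π/2)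
  have h1 := (M_cont 1 hm).intervalIntegrable (μ := MeasureTheory.volume) (-(π/2)) (π/2)
  have h2 := (M_cont 2 hm).intervalIntegrable (μ := MeasureTheory.volume) (-(π/2)) (π/2)
  rw [intervalIntegral.integral_sub ((h0.const_mul _).add (h1.const_mul _)) (h2.const_mul _),
    intervalIntegral.integral_add (h0.const_mul _) (h1.const_mul _)] at key
  simp only [intervalIntegral.integral_const_mul] at key
  unfold Mf
  rw [key]
  simp

lemma E2 {m : ℝ} (hm : 2 < m) : 3 * (m-2) * Mf 1 m + 8 * Mf 2 m - 5 * m * Mf 3 m = 0 := by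
  have key : ∫ t in (-(π/2))..(π/2), (3 * (m-2) * (sin t ^ (2*1) / Rf m t)
      + 8 * (sin t ^ (2*2) / Rf m t) - 5 * m * (sin t ^ (2*3) / Rf m t)) =
      2 * sin (π/2) ^ 3 * cos (π/2) * Rf m (π/2)
        - 2 * sin (-(π/2)) ^ 3 * cos (-(π/2)) * Rf m (-(π/2)) := by
    refine intervalIntegral.integral_eq_sub_of_hasDerivAt
      (f := fun t => 2 * sin t ^ 3 * cos t * Rf m t) (fun t _ => ?_) ?_
    · have h := Rf_pos hm t
      have h' := Rf_sq hm t
      refine (((((hasDerivAt_sin t).pow 3).const_mul 2).mul (hasDerivAt_cos t)).mul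
        (Rf_deriv hm t)).congr_deriv ?_
      simp only [Pi.mul_apply, Pi.pow_apply]
      push_cast
      field_simp
      have hc : cos t ^ 2 = 1 - sin t ^ 2 := by rw [cos_sq']
      ring_nf
      rw [h', hc]
      ring
    · apply Continuous.intervalIntegrable
      have h0 := M_cont 1 hm
      have h1 := M_cont 2 hm
      have h2 := M_cont 3 hm
      fun_prop
  have h0 := (M_cont 1 hm).intervalIntegrable (μ := MeasureTheory.volume) (-(π/2)) (π/2)
  have h1 := (M_cont 2 hm).intervalIntegrable (μ := MeasureTheory.volume) (-(π/2)) (π/2)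
  have h2 := (M_cont 3 hm).intervalIntegrable (μ := MeasureTheory.volume) (-(π/2)) (π/2)
  rw [intervalIntegral.integral_sub ((h0.const_mul _).add (h1.const_mul _)) (h2.const_mul _),
    intervalIntegral.integral_add (h0.const_mul _) (h1.const_mul _)] at key
  simp only [intervalIntegral.integral_const_mul] at key
  unfold Mf
  rw [key]
  simp

lemma Wf_deriv (k : ℕ) {m : ℝ} (hm : 2 < m) :
    HasDerivAt (Wf k) ((Mf k m + Mf (k+1) m) / 4) m := by
  have hd : ∀ x : ℝ, 2 < x → ∀ t, HasDerivAt (fun x => sin t ^ (2*k) * Rf x t)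
      (sin t ^ (2*k) * ((sin t ^ 2 + 1) / 2 / (2 * Rf x t))) x := by
    intro x hx t
    have h1 : HasDerivAt (fun x => (x * sin t ^ 2 + x - 2) / 2) ((sin t ^ 2 + 1) / 2) x := by
      have := ((((hasDerivAt_id x).mul_const (sin t ^ 2)).add (hasDerivAt_id x)).sub_const
        2).div_const 2
      simpa using this
    exact (h1.sqrt (Sf_pos hx t).ne').const_mul _
  have h := (intervalIntegral.hasDerivAt_integral_of_dominated_loc_of_deriv_le
    (μ := MeasureTheory.volume) (a := -(π/2)) (b := π/2)
    (F := fun x t => sin t ^ (2*k) * Rf x t)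
    (F' := fun x t => sin t ^ (2*k) * ((sin t ^ 2 + 1) / 2 / (2 * Rf x t)))
    (x₀ := m) (s := Ioi ((m+2)/2)) (bound := fun _ => 1 / (2 * Real.sqrt ((m-2)/4)))
    (Ioi_mem_nhds (by linarith)) ?_ ?_ ?_ ?_ ?_ ?_).2
  · refine h.congr_deriv (Eq.symm ?_)
    unfold Mf
    have h1 := (M_cont k hm).intervalIntegrable (μ := MeasureTheory.volume) (-(π/2)) (π/2)
    have h2 := (M_cont (k+1) hm).intervalIntegrable (μ := MeasureTheory.volume) (-(π/2)) (π/2)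
    rw [← intervalIntegral.integral_add h1 h2, ← intervalIntegral.integral_div]
    refine intervalIntegral.integral_congr fun t _ => ?_
    have h := Rf_pos hm t
    field_simp
    ring
  · refine Eventually.of_forall fun x => ?_
    have := Rf_cont x
    exact (by fun_prop : Continuous fun t => sin t ^ (2*k) * Rf x t).aestronglyMeasurable
  · have := Rf_cont m
    exact (by fun_prop : Continuous fun t => sin t ^ (2*k) * Rf m t).intervalIntegrable _ _
  · have := Rf_cont m
    refine Continuous.aestronglyMeasurable ?_
    refine Continuous.mul (by fun_prop) (Continuous.div (by fun_prop) (by fun_prop) fun t => ?_)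
    have := Rf_pos hm t
    positivity
  · refine Eventually.of_forall fun t _ x hx => ?_
    have hx' : (m+2)/2 < x := hx
    have hx2 : 2 < x := by linarith
    have hR := Rf_pos hx2 t
    have hs : sin t ^ 2 ≤ 1 := sin_sq_le_one t
    have hs0 : 0 ≤ sin t ^ 2 := sq_nonneg _
    have h1 : sin t ^ (2*k) ≤ 1 := by rw [pow_mul]; exact pow_le_one₀ hs0 hs
    have h10 : 0 ≤ sin t ^ (2*k) := by rw [pow_mul]; positivity
    have h2 : Real.sqrt ((m-2)/4) ≤ Rf x t := by
      apply Real.sqrt_le_sqrt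
      have : 0 ≤ x * sin t ^ 2 := by positivity
      linarith
    have h3 : 0 < Real.sqrt ((m-2)/4) := Real.sqrt_pos.2 (by linarith)
    rw [Real.norm_of_nonneg (by positivity)]
    calc sin t ^ (2*k) * ((sin t ^ 2 + 1) / 2 / (2 * Rf x t))
        ≤ 1 * ((sin t ^ 2 + 1) / 2 / (2 * Rf x t)) := by gcongr
      _ ≤ 1 / (2 * Real.sqrt ((m-2)/4)) := by
        rw [one_mul]
        gcongr
        linarith
  · exact intervalIntegrable_const
  · refine Eventually.of_forall fun t _ x hx => ?_
    have hx' : (m+2)/2 < x := hx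
    exact hd x (by linarith) t

lemma Wf_cont (k : ℕ) : Continuous (Wf k) := by
  unfold Wf Rf
  refine intervalIntegral.continuous_parametric_intervalIntegral_of_continuous' ?_ _ _
  simp only [Function.uncurry_def]
  fun_prop

lemma xmax_sq {h : ℝ} : xmax h ^ 2 = 1 + Real.sqrt (1 + 4*h) :=
  Real.sq_sqrt (by positivity)

lemma m_gt {h : ℝ} (hh : 0 < h) : 2 < 1 + Real.sqrt (1 + 4*h) := by
  have : 1 < Real.sqrt (1 + 4*h) := by
    rw [Real.lt_sqrt (by norm_num)]; linarith
  linarith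

lemma m_rel {h : ℝ} (hh : 0 < h) :
    4 * h = (1 + Real.sqrt (1 + 4*h)) * ((1 + Real.sqrt (1 + 4*h)) - 2) := by
  have : Real.sqrt (1 + 4*h) ^ 2 = 1 + 4*h := Real.sq_sqrt (by linarith)
  nlinarith

lemma subst_int {h : ℝ} (g : ℝ → ℝ) :
    ∫ x in (-xmax h)..(xmax h), g x
      = ∫ t in (-(π/2))..(π/2), g (xmax h * sin t) * (xmax h * cos t) := by
  have hp : -(π/2) ≤ π/2 := by linarith [pi_pos]
  have := intervalIntegral.integral_comp_mul_deriv_of_deriv_nonneg (a := -(π/2)) (b := π/2)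
    (f := fun t => xmax h * sin t) (f' := fun t => xmax h * cos t) (g := g)
    (by fun_prop) (fun t _ => (hasDerivAt_sin t).const_mul _) (fun t ht => by
      rw [min_eq_left hp, max_eq_right hp] at ht
      have := cos_pos_of_mem_Ioo ht
      have : 0 ≤ xmax h := Real.sqrt_nonneg _
      positivity)
  simp only [Function.comp_def] at this
  rw [this]
  simp

lemma sqrt_fac {h : ℝ} (hh : 0 < h) {t : ℝ} (ht : 0 ≤ cos t) :
    Real.sqrt (2*h + (xmax h * sin t)^2 - (xmax h * sin t)^4/2)
      = xmax h * cos t * Rf (1 + Real.sqrt (1 + 4*h)) t := by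
  have h0 : 0 ≤ xmax h := Real.sqrt_nonneg _
  have hR := Rf_pos (m_gt hh) t
  rw [← Real.sqrt_sq (by positivity : 0 ≤ xmax h * cos t * Rf (1 + Real.sqrt (1 + 4*h)) t)]
  congr 1
  have e : xmax h ^ 4 = (xmax h ^ 2) ^ 2 := by ring
  rw [mul_pow, mul_pow, mul_pow, mul_pow, Rf_sq (m_gt hh), cos_sq', e, xmax_sq]
  linear_combination (1/2) * m_rel hh

lemma cos_nonneg_uIcc {t : ℝ} (ht : t ∈ uIcc (-(π/2)) (π/2)) : 0 ≤ cos t := by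
  rw [uIcc_of_le (by linarith [pi_pos])] at ht
  exact cos_nonneg_of_mem_Icc ht

lemma W_integrable (k : ℕ) (m : ℝ) :
    IntervalIntegrable (fun t => sin t ^ (2*k) * Rf m t) MeasureTheory.volume (-(π/2)) (π/2) := by
  have := Rf_cont m
  exact (by fun_prop : Continuous fun t => sin t ^ (2*k) * Rf m t).intervalIntegrable _ _

lemma ellI0_eq {h : ℝ} (hh : 0 < h) : ellI 0 h =
    (1 + Real.sqrt (1 + 4*h)) *
      (Wf 0 (1 + Real.sqrt (1 + 4*h)) - Wf 1 (1 + Real.sqrt (1 + 4*h))) := by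
  unfold ellI Wf
  rw [subst_int, ← intervalIntegral.integral_sub (W_integrable _ _) (W_integrable _ _),
    ← intervalIntegral.integral_const_mul]
  refine intervalIntegral.integral_congr fun t ht => ?_
  rw [sqrt_fac hh (cos_nonneg_uIcc ht), ← xmax_sq]
  have hc : cos t ^ 2 = 1 - sin t ^ 2 := by rw [cos_sq']
  linear_combination (xmax h ^ 2 * Rf (xmax h ^ 2) t) * hc

lemma ellI2_eq {h : ℝ} (hh : 0 < h) : ellI 2 h =
    (1 + Real.sqrt (1 + 4*h)) ^ 2 *
      (Wf 1 (1 + Real.sqrt (1 + 4*h)) - Wf 2 (1 + Real.sqrt (1 + 4*h))) := by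
  unfold ellI Wf
  rw [subst_int, ← intervalIntegral.integral_sub (W_integrable _ _) (W_integrable _ _),
    ← intervalIntegral.integral_const_mul]
  refine intervalIntegral.integral_congr fun t ht => ?_
  rw [sqrt_fac hh (cos_nonneg_uIcc ht), ← xmax_sq]
  have hc : cos t ^ 2 = 1 - sin t ^ 2 := by rw [cos_sq']
  linear_combination (xmax h ^ 4 * sin t ^ 2 * Rf (xmax h ^ 2) t) * hc

lemma ellI4_eq {h : ℝ} (hh : 0 < h) : ellI' 4 h =
    (1 + Real.sqrt (1 + 4*h)) ^ 2 * Mf 2 (1 + Real.sqrt (1 + 4*h)) := by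
  unfold ellI' Mf
  have hp : -(π/2) ≤ π/2 := by linarith [pi_pos]
  rw [subst_int, ← intervalIntegral.integral_const_mul]
  refine intervalIntegral.integral_congr_Ioo_of_le hp fun t ht => ?_
  have hc := cos_pos_of_mem_Ioo ht
  rw [sqrt_fac hh hc.le]
  have hx : 0 < xmax h := Real.sqrt_pos.2 (by positivity)
  have hR := Rf_pos (m_gt hh) t
  rw [← xmax_sq] at *
  field_simp

lemma Wf_two (k : ℕ) : Wf k 2 = 2 * ∫ t in (0:ℝ)..(π/2), sin t ^ (2*k+1) := by
  have e : ∀ t, sin t ^ (2*k) * Rf 2 t = sin t ^ (2*k) * |sin t| := by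
    intro t
    unfold Rf
    rw [← Real.sqrt_sq_eq_abs]
    congr 2
    ring
  unfold Wf
  simp only [e]
  have hc : Continuous fun t => sin t ^ (2*k) * |sin t| := by fun_prop
  rw [← intervalIntegral.integral_add_adjacent_intervals (b := 0)
    (hc.intervalIntegrable _ _) (hc.intervalIntegrable _ _)]
  have h1 : ∫ t in (-(π/2))..0, sin t ^ (2*k) * |sin t|
      = ∫ t in (0:ℝ)..(π/2), sin t ^ (2*k) * |sin t| := by
    have := intervalIntegral.integral_comp_neg (a := 0) (b := π/2)
      (fun t => sin t ^ (2*k) * |sin t|)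
    simp only [sin_neg, abs_neg, neg_zero, Even.neg_pow (even_two_mul k)] at this
    exact this.symm
  have h2 : ∫ t in (0:ℝ)..(π/2), sin t ^ (2*k) * |sin t|
      = ∫ t in (0:ℝ)..(π/2), sin t ^ (2*k+1) := by
    refine intervalIntegral.integral_congr fun t ht => ?_
    rw [uIcc_of_le (by linarith [pi_pos])] at ht
    have : 0 ≤ sin t := sin_nonneg_of_nonneg_of_le_pi ht.1 (by linarith [ht.2, pi_pos])
    rw [abs_of_nonneg this, pow_succ]
  rw [h1, h2]
  ring

lemma Wf_vals : Wf 0 2 = 2 ∧ Wf 1 2 = 4/3 ∧ Wf 2 2 = 16/15 := by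
  have h1 : ∫ t in (0:ℝ)..(π/2), sin t ^ 1 = 1 := by simp
  have h3 : ∫ t in (0:ℝ)..(π/2), sin t ^ 3 = 2/3 := by
    rw [integral_sin_pow (n := 1), h1]; norm_num
  have h5 : ∫ t in (0:ℝ)..(π/2), sin t ^ 5 = 8/15 := by
    rw [integral_sin_pow (n := 3), h3]; norm_num
  refine ⟨?_, ?_, ?_⟩ <;> rw [Wf_two]
  · norm_num
  · norm_num [h3]
  · norm_num [h5]

lemma m_tendsto : Tendsto (fun h : ℝ => 1 + Real.sqrt (1 + 4*h)) (𝓝[>] 0) (𝓝 2) := by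
  have : Continuous (fun h : ℝ => 1 + Real.sqrt (1 + 4*h)) := by fun_prop
  have := (this.tendsto 0).mono_left (nhdsWithin_le_nhds (s := Ioi 0))
  norm_num at this
  exact this

lemma ellI0_tendsto : Tendsto (ellI 0) (𝓝[>] 0) (𝓝 (4/3)) := by
  have hc : Continuous fun m => m * (Wf 0 m - Wf 1 m) :=
    continuous_id.mul ((Wf_cont 0).sub (Wf_cont 1))
  have h1 := (hc.tendsto 2).comp m_tendsto
  obtain ⟨v0, v1, v2⟩ := Wf_vals
  rw [v0, v1] at h1
  norm_num at h1
  refine h1.congr' ?_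
  filter_upwards [self_mem_nhdsWithin] with h hh
  exact (ellI0_eq hh).symm

lemma ellI2_tendsto : Tendsto (ellI 2) (𝓝[>] 0) (𝓝 (16/15)) := by
  have hc : Continuous fun m => m ^ 2 * (Wf 1 m - Wf 2 m) :=
    (continuous_id.pow 2).mul ((Wf_cont 1).sub (Wf_cont 2))
  have h1 := (hc.tendsto 2).comp m_tendsto
  obtain ⟨v0, v1, v2⟩ := Wf_vals
  rw [v1, v2] at h1
  norm_num at h1
  refine h1.congr' ?_
  filter_upwards [self_mem_nhdsWithin] with h hh
  exact (ellI2_eq hh).symm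

noncomputable def Lf (h : ℝ) : ℝ := Mf 0 (1 + Real.sqrt (1 + 4*h))
noncomputable def Kf (h : ℝ) : ℝ :=
  (1 + Real.sqrt (1 + 4*h)) * Mf 1 (1 + Real.sqrt (1 + 4*h))

lemma m_deriv {h : ℝ} (hh : 0 < h) :
    HasDerivAt (fun h : ℝ => 1 + Real.sqrt (1 + 4*h)) (2 / Real.sqrt (1 + 4*h)) h := by
  have h1 : HasDerivAt (fun h : ℝ => 1 + 4*h) 4 h := by
    simpa using ((hasDerivAt_id h).const_mul 4).const_add 1
  refine ((h1.sqrt (by positivity)).const_add 1).congr_deriv ?_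
  have : 0 < Real.sqrt (1 + 4*h) := Real.sqrt_pos.2 (by positivity)
  field_simp
  norm_num

lemma ellI0_deriv {h : ℝ} (hh : 0 < h) : HasDerivAt (ellI 0) (Lf h) h := by
  have hm := m_gt hh
  have h1 : HasDerivAt (fun m => m * (Wf 0 m - Wf 1 m)) _ (1 + Real.sqrt (1 + 4*h)) :=
    (hasDerivAt_id _).mul ((Wf_deriv 0 hm).sub (Wf_deriv 1 hm))
  have h2 := (h1.comp h (m_deriv hh)).congr_of_eventuallyEq (f₁ := ellI 0) (by
    filter_upwards [Ioi_mem_nhds hh] with x hx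
    exact ellI0_eq hx)
  refine h2.congr_deriv ?_
  have hs : 0 < Real.sqrt (1 + 4*h) := Real.sqrt_pos.2 (by positivity)
  simp only [Lf, Wf_eq _ hm]
  have e1 := E1 hm
  norm_num
  set s := Real.sqrt (1 + 4*h)
  field_simp
  linear_combination 2 * e1

lemma ellI2_deriv {h : ℝ} (hh : 0 < h) : HasDerivAt (ellI 2) (Kf h) h := by
  have hm := m_gt hh
  have h1 : HasDerivAt (fun m => m ^ 2 * (Wf 1 m - Wf 2 m)) _ (1 + Real.sqrt (1 + 4*h)) :=
    ((hasDerivAt_id _).pow 2).mul ((Wf_deriv 1 hm).sub (Wf_deriv 2 hm))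
  have h2 := (h1.comp h (m_deriv hh)).congr_of_eventuallyEq (f₁ := ellI 2) (by
    filter_upwards [Ioi_mem_nhds hh] with x hx
    exact ellI2_eq hx)
  refine h2.congr_deriv ?_
  have hs : 0 < Real.sqrt (1 + 4*h) := Real.sqrt_pos.2 (by positivity)
  simp only [Pi.pow_apply, Kf, Wf_eq _ hm]
  have e1 := E2 hm
  norm_num
  set s := Real.sqrt (1 + 4*h)
  field_simp
  linear_combination 2 * e1

lemma rel1 {h : ℝ} (hh : 0 < h) : 3 * ellI 0 h = 4 * h * Lf h + Kf h := by
  have hm := m_gt hh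
  have e1 := E1 hm
  have hr := m_rel hh
  rw [ellI0_eq hh, Lf, Kf, Wf_eq _ hm, Wf_eq _ hm]
  norm_num
  set m := 1 + Real.sqrt (1 + 4*h)
  linear_combination (m/2) * e1 - Mf 0 m * hr

lemma rel2 {h : ℝ} (hh : 0 < h) : (1 + 4*h) * Kf h = 5 * ellI 2 h - ellI 0 h := by
  have hm := m_gt hh
  have e1 := E1 hm
  have e2 := E2 hm
  have hr := m_rel hh
  rw [ellI0_eq hh, ellI2_eq hh, Kf, Wf_eq _ hm, Wf_eq _ hm, Wf_eq _ hm]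
  norm_num
  set m := 1 + Real.sqrt (1 + 4*h)
  linear_combination (m/2) * e1 - (m^2/2) * e2 + m * Mf 1 m * hr

lemma rel3 {h : ℝ} (hh : 0 < h) : ellI' 4 h = 5 * ellI 2 h - 4 * h * Kf h := by
  have hm := m_gt hh
  have e2 := E2 hm
  have hr := m_rel hh
  rw [ellI4_eq hh, ellI2_eq hh, Kf, Wf_eq _ hm, Wf_eq _ hm]
  norm_num
  set m := 1 + Real.sqrt (1 + 4*h)
  linear_combination - (m^2/2) * e2 + m * Mf 1 m * hr

lemma Lf_nonneg {h : ℝ} (hh : 0 < h) : 0 ≤ Lf h := by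
  unfold Lf Mf
  refine intervalIntegral.integral_nonneg (by linarith [pi_pos]) fun t _ => ?_
  have := Rf_pos (m_gt hh) t
  have h2 : 0 ≤ sin t ^ (2*0) := by simp
  positivity

/-- The abstract Chebyshev argument. -/
lemma abstract_cheb (A B L K : ℝ → ℝ)
    (hA : ∀ h, 0 < h → HasDerivAt A (L h) h) (hB : ∀ h, 0 < h → HasDerivAt B (K h) h)
    (r1 : ∀ h, 0 < h → 3 * A h = 4 * h * L h + K h)
    (r2 : ∀ h, 0 < h → (1 + 4*h) * K h = 5 * B h - A h)
    (hL : ∀ h, 0 < h → 0 ≤ L h)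
    (tA : Tendsto A (𝓝[>] 0) (𝓝 (4/3))) (tB : Tendsto B (𝓝[>] 0) (𝓝 (16/15))) :
    ∃ δ : ℝ, 0 < δ ∧ ∀ a b c : ℝ, (∃ x y z, 0 < x ∧ x < y ∧ y < z ∧ z < δ ∧
      a * A x + b * B x + c * (x * K x) = 0 ∧ a * A y + b * B y + c * (y * K y) = 0 ∧
      a * A z + b * B z + c * (z * K z) = 0) → a = 0 ∧ b = 0 ∧ c = 0 := by
  have tid : Tendsto (fun h : ℝ => h) (𝓝[>] 0) (𝓝 0) := nhdsWithin_le_nhds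
  -- derivatives of K and L
  set P : ℝ → ℝ := fun h => (K h - L h) / (1 + 4*h) with hPdef
  have d4 : ∀ h : ℝ, HasDerivAt (fun h : ℝ => 1 + 4*h) 4 h := fun h => by
    simpa using ((hasDerivAt_id h).const_mul 4).const_add 1
  have hK : ∀ h, 0 < h → HasDerivAt K (P h) h := by
    intro h hh
    have h1 := (((hB h hh).const_mul 5).sub (hA h hh)).div (d4 h) (by positivity)
    refine (h1.congr_of_eventuallyEq ?_).congr_deriv ?_
    · filter_upwards [Ioi_mem_nhds hh] with x hx
      have hx' : 0 < x := hx
      have := r2 x hx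
      simp only [Pi.div_apply, Pi.sub_apply]
      rw [eq_div_iff (by positivity)]
      linarith
    · simp only [hPdef, Pi.sub_apply]
      have := r2 h hh
      field_simp
      linear_combination 4 * this
  set L' : ℝ → ℝ := fun h => -(K h + 4 * h * L h) / (4 * h * (1 + 4*h)) with hL'def
  have hLd : ∀ h, 0 < h → HasDerivAt L (L' h) h := by
    intro h hh
    have d5 : HasDerivAt (fun h : ℝ => 4*h) 4 h := by
      simpa using (hasDerivAt_id h).const_mul 4
    have h1 := (((hA h hh).const_mul 3).sub (hK h hh)).div d5 (by positivity)
    refine (h1.congr_of_eventuallyEq ?_).congr_deriv ?_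
    · filter_upwards [Ioi_mem_nhds hh] with x hx
      have hx' : 0 < x := hx
      have := r1 x hx
      simp only [Pi.div_apply, Pi.sub_apply]
      rw [eq_div_iff (by positivity)]
      linarith
    · simp only [hPdef, hL'def, Pi.sub_apply]
      have := r1 h hh
      field_simp
      linear_combination (-1) * (1 + 4 * h) * this
  -- limits
  have te : Tendsto (fun h : ℝ => 1 / (1 + 4*h)) (𝓝[>] 0) (𝓝 1) := by
    have : Tendsto (fun h : ℝ => 1 / (1 + 4*h)) (𝓝[>] 0) (𝓝 (1 / (1 + 4 * 0))) :=
      tendsto_const_nhds.div (tendsto_const_nhds.add (tid.const_mul 4)) (by norm_num)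
    simpa using this
  have tK : Tendsto K (𝓝[>] 0) (𝓝 4) := by
    have h1 : Tendsto (fun h => (5 * B h - A h) * (1 / (1 + 4*h))) (𝓝[>] 0)
      (𝓝 ((5 * (16/15) - 4/3) * 1)) := ((tB.const_mul 5).sub tA).mul te
    norm_num at h1
    refine h1.congr' ?_
    filter_upwards [self_mem_nhdsWithin] with h hh
    have hh' : 0 < h := hh
    rw [← r2 h hh]
    field_simp
  have tl1 : Tendsto (fun h => h * L h) (𝓝[>] 0) (𝓝 0) := by
    have h1 : Tendsto (fun h => (3 * A h - K h) / 4) (𝓝[>] 0) (𝓝 ((3 * (4/3) - 4)/4)) :=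
      ((tA.const_mul 3).sub tK).div_const 4
    norm_num at h1
    refine h1.congr' ?_
    filter_upwards [self_mem_nhdsWithin] with h hh
    rw [r1 h hh]
    ring
  have tl2 : Tendsto (fun h => h * L h ^ 2) (𝓝[>] 0) (𝓝 0) := by
    have hev : ∀ᶠ h in 𝓝[>] (0:ℝ), K h + 4 * (h * L h) < 8 :=
      (tK.add (tl1.const_mul 4)).eventually_lt_const (by norm_num)
    obtain ⟨d, hd, hd2⟩ := mem_nhdsGT_iff_exists_Ioo_subset.1 hev
    have hd0 : 0 < d := hd
    have hmono : MonotoneOn (fun h => L h + 2 * Real.log h) (Ioo 0 d) := by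
      have hder : ∀ x ∈ Ioo 0 d, HasDerivAt (fun h => L h + 2 * Real.log h) (L' x + 2 * x⁻¹) x :=
        fun x hx => (hLd x hx.1).add ((Real.hasDerivAt_log hx.1.ne').const_mul 2)
      refine monotoneOn_of_deriv_nonneg (convex_Ioo _ _)
        (fun x hx => (hder x hx).continuousAt.continuousWithinAt)
        (fun x hx => ?_) (fun x hx => ?_)
      · rw [interior_Ioo] at hx
        exact (hder x hx).differentiableAt.differentiableWithinAt
      · rw [interior_Ioo] at hx
        rw [(hder x hx).deriv]
        have h1 : K x + 4 * (x * L x) < 8 := hd2 hx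
        have hx0 := hx.1
        simp only [hL'def]
        have : -(K x + 4 * x * L x) / (4 * x * (1 + 4 * x)) + 2 * x⁻¹ =
          (8 * (1 + 4*x) - (K x + 4 * (x * L x))) / (4 * x * (1 + 4 * x)) := by
          field_simp
          ring
        rw [this]
        apply div_nonneg _ (by positivity)
        linarith
    set C := L (d/2) + 2 * Real.log (d/2) with hC
    have hub : ∀ᶠ h in 𝓝[>] (0:ℝ), L h ≤ C - 2 * Real.log h := by
      filter_upwards [Ioo_mem_nhdsGT (by positivity : 0 < d/2)] with h hh
      have := hmono ⟨hh.1, by linarith [hh.2]⟩ (⟨by positivity, by linarith⟩ : d/2 ∈ Ioo 0 d) hh.2.le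
      simp only at this
      linarith
    have tr : Tendsto (fun h : ℝ => h ^ (1/2 : ℝ)) (𝓝[>] 0) (𝓝 0) := by
      have := (Real.continuous_rpow_const (by norm_num : (0:ℝ) ≤ 1/2)).tendsto 0
      rw [Real.zero_rpow (by norm_num)] at this
      exact this.mono_left nhdsWithin_le_nhds
    have tu : Tendsto (fun h : ℝ => C * h ^ (1/2 : ℝ) - 2 * (Real.log h * h ^ (1/2 : ℝ)))
        (𝓝[>] 0) (𝓝 0) := by
      simpa using (tr.const_mul C).sub
        ((tendsto_log_mul_rpow_nhdsGT_zero (by norm_num : (0:ℝ) < 1/2)).const_mul 2)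
    have t0 : Tendsto (fun h => L h * h ^ (1/2 : ℝ)) (𝓝[>] 0) (𝓝 0) := by
      refine tendsto_of_tendsto_of_tendsto_of_le_of_le' tendsto_const_nhds tu ?_ ?_
      · filter_upwards [self_mem_nhdsWithin] with h hh
        have hh' : 0 < h := hh
        have := hL h hh
        positivity
      · filter_upwards [self_mem_nhdsWithin, hub] with h hh hu
        have hh' : 0 < h := hh
        have := mul_le_mul_of_nonneg_right hu (Real.rpow_nonneg hh'.le (1/2))
        linarith
    have t1 := t0.pow 2
    norm_num only at t1
    refine t1.congr' ?_
    filter_upwards [self_mem_nhdsWithin] with h hh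
    have hh' : 0 < h := hh
    rw [mul_pow, ← Real.rpow_natCast (h ^ _), ← Real.rpow_mul hh'.le]
    norm_num
    ring
  -- the Wronskian type quantities
  set P' : ℝ → ℝ := fun h => -(3 * P h + L' h) / (1 + 4*h) with hP'def
  have hPd : ∀ h, 0 < h → HasDerivAt P (P' h) h := by
    intro h hh
    refine (((hK h hh).sub (hLd h hh)).div (d4 h) (by positivity)).congr_deriv ?_
    simp only [hP'def, Pi.sub_apply]
    have : P h * (1 + 4*h) = K h - L h := by
      simp only [hPdef]; field_simp
    rw [← this]
    field_simp
    ring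
  set N : ℝ → ℝ := fun h => L h * B h - A h * K h with hNdef
  set D : ℝ → ℝ := fun h => B h * K h + h * (P h * B h - K h ^ 2) with hDdef
  set N' : ℝ → ℝ := fun h => L' h * B h - A h * P h with hN'def
  set D' : ℝ → ℝ := fun h => 2 * (B h * P h) + h * (P' h * B h - K h * P h) with hD'def
  have hN : ∀ h, 0 < h → HasDerivAt N (N' h) h := by
    intro h hh
    refine (((hLd h hh).mul (hB h hh)).sub ((hA h hh).mul (hK h hh))).congr_deriv ?_
    simp only [hN'def]
    ring
  have hD : ∀ h, 0 < h → HasDerivAt D (D' h) h := by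
    intro h hh
    refine (((hB h hh).mul (hK h hh)).add ((hasDerivAt_id h).mul
      (((hPd h hh).mul (hB h hh)).sub ((hK h hh).pow 2)))).congr_deriv ?_
    simp only [hD'def, Pi.sub_apply, Pi.mul_apply, Pi.pow_apply, id]
    push_cast
    ring
  have tP : Tendsto (fun h => h * P h) (𝓝[>] 0) (𝓝 0) := by
    have h1 : Tendsto (fun h => (h * K h - h * L h) * (1 / (1 + 4*h))) (𝓝[>] 0)
      (𝓝 ((0 * 4 - 0) * 1)) := ((tid.mul tK).sub tl1).mul te
    norm_num only at h1
    refine h1.congr fun h => ?_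
    simp only [hPdef]
    ring
  have tPL : Tendsto (fun h => h * P h * L h) (𝓝[>] 0) (𝓝 0) := by
    have h1 : Tendsto (fun h => (h * L h * K h - h * L h ^ 2) * (1 / (1 + 4*h))) (𝓝[>] 0)
      (𝓝 ((0 * 4 - 0) * 1)) := ((tl1.mul tK).sub tl2).mul te
    norm_num only at h1
    refine h1.congr fun h => ?_
    simp only [hPdef]
    ring
  have tL' : Tendsto (fun h => h * L' h) (𝓝[>] 0) (𝓝 (-1)) := by
    have h1 : Tendsto (fun h => -(K h + 4 * (h * L h)) / 4 * (1 / (1 + 4*h))) (𝓝[>] 0)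
      (𝓝 (-(4 + 4 * 0) / 4 * 1)) := ((tK.add (tl1.const_mul 4)).neg.div_const 4).mul te
    norm_num only at h1
    refine h1.congr' ?_
    filter_upwards [self_mem_nhdsWithin] with h hh
    have hh' : 0 < h := hh
    simp only [hL'def]
    field_simp
  have tP' : Tendsto (fun h => h * P' h) (𝓝[>] 0) (𝓝 1) := by
    have h1 : Tendsto (fun h => -(3 * (h * P h) + h * L' h) * (1 / (1 + 4*h))) (𝓝[>] 0)
      (𝓝 (-(3 * 0 + -1) * 1)) := ((tP.const_mul 3).add tL').neg.mul te
    norm_num only at h1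
    refine h1.congr fun h => ?_
    simp only [hP'def]
    ring
  have tD : Tendsto D (𝓝[>] 0) (𝓝 (64/15)) := by
    have h1 : Tendsto (fun h => B h * K h + (h * P h * B h - h * K h ^ 2)) (𝓝[>] 0)
      (𝓝 (16/15 * 4 + (0 * (16/15) - 0 * 4 ^ 2))) :=
      (tB.mul tK).add ((tP.mul tB).sub (tid.mul (tK.pow 2)))
    norm_num only at h1
    refine h1.congr fun h => ?_
    simp only [hDdef]
    ring
  have tN' : Tendsto (fun h => h * N' h) (𝓝[>] 0) (𝓝 (-16/15)) := by
    have h1 : Tendsto (fun h => h * L' h * B h - A h * (h * P h)) (𝓝[>] 0)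
      (𝓝 (-1 * (16/15) - 4/3 * 0)) := (tL'.mul tB).sub (tA.mul tP)
    norm_num only at h1
    norm_num only
    refine h1.congr fun h => ?_
    simp only [hN'def]
    ring
  have tND' : Tendsto (fun h => h * (N h * D' h)) (𝓝[>] 0) (𝓝 0) := by
    have h1 : Tendsto (fun h =>
        (2 * B h - h * K h) * (B h * (h * P h * L h) - A h * K h * (h * P h))
        + h * P' h * B h * (h * L h * B h - h * (A h * K h))) (𝓝[>] 0)
      (𝓝 ((2 * (16/15) - 0 * 4) * (16/15 * 0 - 4/3 * 4 * 0)
        + 1 * (16/15) * (0 * (16/15) - 0 * (4/3 * 4)))) :=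
      (((tB.const_mul 2).sub (tid.mul tK)).mul ((tB.mul tPL).sub ((tA.mul tK).mul tP))).add
        ((tP'.mul tB).mul ((tl1.mul tB).sub (tid.mul (tA.mul tK))))
    norm_num only at h1
    refine h1.congr fun h => ?_
    simp only [hNdef, hD'def]
    ring
  have tW : Tendsto (fun h => h * N' h * D h - h * (N h * D' h)) (𝓝[>] 0)
      (𝓝 (-16/15 * (64/15) - 0)) := (tN'.mul tD).sub tND'
  have ev := (tW.eventually_lt_const (by norm_num : (-16/15 * (64/15) - 0 : ℝ) < 0)).and
    ((tD.eventually_const_lt (by norm_num : (0:ℝ) < 64/15)).and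
      (tB.eventually_const_lt (by norm_num : (0:ℝ) < 16/15)))
  obtain ⟨δ, hδ, hδ2⟩ := mem_nhdsGT_iff_exists_Ioo_subset.1 ev
  have hWneg : ∀ h ∈ Ioo 0 δ, N' h * D h - N h * D' h < 0 := by
    intro h hh
    have h1 : h * N' h * D h - h * (N h * D' h) < 0 := (hδ2 hh).1
    have h0 : 0 < h := hh.1
    by_contra hcon
    push Not at hcon
    have := mul_nonneg h0.le hcon
    nlinarith
  have hDpos : ∀ h ∈ Ioo 0 δ, 0 < D h := fun h hh => (hδ2 hh).2.1
  have hBpos : ∀ h ∈ Ioo 0 δ, 0 < B h := fun h hh => (hδ2 hh).2.2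
  refine ⟨δ, hδ, ?_⟩
  rintro a b c ⟨x, y, z, hx, hxy, hyz, hz, fx, fy, fz⟩
  -- first division and differentiation
  have hG : ∀ h ∈ Ioo 0 δ, HasDerivAt (fun h => (a * A h + b * B h + c * (h * K h)) / B h)
      ((a * N h + c * D h) / B h ^ 2) h := by
    intro h hh
    have hb := hBpos h hh
    refine (((((hA h hh.1).const_mul a).add ((hB h hh.1).const_mul b)).add
      (((hasDerivAt_id h).mul (hK h hh.1)).const_mul c)).div (hB h hh.1) hb.ne').congr_deriv ?_
    simp only [hNdef, hDdef, Pi.add_apply, Pi.mul_apply, id]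
    congr 1
    ring
  have rolle1 : ∀ u v, 0 < u → u < v → v < δ → a * A u + b * B u + c * (u * K u) = 0 →
      a * A v + b * B v + c * (v * K v) = 0 → ∃ w ∈ Ioo u v, a * N w + c * D w = 0 := by
    intro u v hu huv hv fu fv
    have sub : ∀ t, u ≤ t → t ≤ v → t ∈ Ioo 0 δ := fun t h1 h2 => ⟨by linarith, by linarith⟩
    obtain ⟨w, hw, hw2⟩ := exists_hasDerivAt_eq_zero huv
      (f := fun h => (a * A h + b * B h + c * (h * K h)) / B h)
      (f' := fun h => (a * N h + c * D h) / B h ^ 2)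
      (fun t ht => (hG t (sub t ht.1 ht.2)).continuousAt.continuousWithinAt)
      (by simp only [fu, fv, zero_div]) (fun t ht => hG t (sub t ht.1.le ht.2.le))
    refine ⟨w, hw, ?_⟩
    have hb := hBpos w (sub w hw.1.le hw.2.le)
    rcases div_eq_zero_iff.1 hw2 with h | h
    · exact h
    · exact absurd h (by positivity)
  obtain ⟨p, hp, fp⟩ := rolle1 x y hx hxy (by linarith) fx fy
  obtain ⟨q, hq, fq⟩ := rolle1 y z (by linarith) hyz hz fy fz
  have sub : ∀ t, p ≤ t → t ≤ q → t ∈ Ioo 0 δ :=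
    fun t h1 h2 => ⟨by linarith [hp.1], by linarith [hq.2]⟩
  have hQ : ∀ h ∈ Ioo 0 δ, HasDerivAt (fun h => (a * N h + c * D h) / D h)
      (a * (N' h * D h - N h * D' h) / D h ^ 2) h := by
    intro h hh
    refine ((((hN h hh.1).const_mul a).add ((hD h hh.1).const_mul c)).div (hD h hh.1)
      (hDpos h hh).ne').congr_deriv ?_
    simp only [Pi.add_apply]
    congr 1
    ring
  obtain ⟨w, hw, hw2⟩ := exists_hasDerivAt_eq_zero (by linarith [hp.2, hq.1] : p < q)
    (f := fun h => (a * N h + c * D h) / D h)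
    (f' := fun h => a * (N' h * D h - N h * D' h) / D h ^ 2)
    (fun t ht => (hQ t (sub t ht.1 ht.2)).continuousAt.continuousWithinAt)
    (by simp only [fp, fq, zero_div]) (fun t ht => hQ t (sub t ht.1.le ht.2.le))
  have hwm := sub w hw.1.le hw.2.le
  have ha : a = 0 := by
    have hd := hDpos w hwm
    have hn := hWneg w hwm
    rcases div_eq_zero_iff.1 hw2 with h | h
    · rcases mul_eq_zero.1 h with h | h
      · exact h
      · exact absurd h hn.ne
    · exact absurd h (by positivity)
  have hpm : p ∈ Ioo 0 δ := ⟨by linarith [hp.1], by linarith [hp.2]⟩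
  have hc : c = 0 := by
    have hd := hDpos p hpm
    rw [ha, zero_mul, zero_add] at fp
    exact (mul_eq_zero.1 fp).resolve_right hd.ne'
  refine ⟨ha, ?_, hc⟩
  have hb := hBpos x ⟨hx, by linarith⟩
  rw [ha, hc, zero_mul, zero_mul, zero_add, add_zero] at fx
  exact (mul_eq_zero.1 fx).resolve_right (ne_of_gt hb)

/-- At most two zeros of the Melnikov functions bifurcate from the figure-eight. -/
theorem melnikov_at_most_two_zeros :
    ∃ δ : ℝ, 0 < δ ∧ ∀ a b c : ℝ, (a, b, c) ≠ (0, 0, 0) →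
      {h : ℝ | h ∈ Ioo 0 δ ∧ a * ellI 0 h + b * ellI 2 h + c * ellI' 4 h = 0}.encard ≤ 2 := by
  obtain ⟨δ, hδ, H⟩ := abstract_cheb (ellI 0) (ellI 2) Lf Kf (fun h hh => ellI0_deriv hh)
    (fun h hh => ellI2_deriv hh) (fun h hh => rel1 hh) (fun h hh => rel2 hh)
    (fun h hh => Lf_nonneg hh) ellI0_tendsto ellI2_tendsto
  refine ⟨δ, hδ, fun a b c habc => ?_⟩
  by_contra hcon
  push Not at hcon
  set S := {h : ℝ | h ∈ Ioo 0 δ ∧ a * ellI 0 h + b * ellI 2 h + c * ellI' 4 h = 0} with hS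
  have key : ∀ x ∈ S, a * ellI 0 x + (b + 5 * c) * ellI 2 x + (-4 * c) * (x * Kf x) = 0 := by
    intro x hx
    have h1 := hx.2
    rw [rel3 hx.1.1] at h1
    linarith
  have main : ∀ x ∈ S, ∀ y ∈ S, ∀ z ∈ S, x < y → y < z → False := by
    intro x hx y hy z hz hxy hyz
    obtain ⟨ha, hb, hc⟩ := H a (b + 5 * c) (-4 * c)
      ⟨x, y, z, hx.1.1, hxy, hyz, hz.1.2, key x hx, key y hy, key z hz⟩
    have hc' : c = 0 := by linarith
    have hb' : b = 0 := by linarith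
    exact habc (by rw [ha, hb', hc'])
  have h3 : (3 : ℕ∞) ≤ S.encard := by
    have := Order.add_one_le_of_lt hcon
    norm_num at this
    exact this
  obtain ⟨T, hT, hT3⟩ := Set.exists_subset_encard_eq h3
  obtain ⟨x, y, z, hxy, hxz, hyz, rfl⟩ := Set.encard_eq_three.1 hT3
  have hx : x ∈ S := hT (by simp)
  have hy : y ∈ S := hT (by simp)
  have hz : z ∈ S := hT (by simp)
  rcases lt_or_gt_of_ne hxy with h1 | h1 <;> rcases lt_or_gt_of_ne hxz with h2 | h2 <;>
    rcases lt_or_gt_of_ne hyz with h3 | h3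
  · exact main x hx y hy z hz h1 h3
  · exact main x hx z hz y hy h2 h3
  · linarith
  · exact main z hz x hx y hy h2 h1
  · exact main y hy x hx z hz h1 h2
  · linarith
  · exact main y hy z hz x hx h3 h2
  · exact main z hz y hy x hx h3 h1
end
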